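/- Let P be a finite poc set. Then the function d∞ on pairs of ultrafilters of P, defined as the maximum cardinality of a nested subset of U ∖ W, is a metric on the set of ultrafilters of P: d∞(U,W) = 0 if and only if U = W, d∞(U,W) = d∞(W,U), and d∞(U,W) ≤ d∞(U,V) + d∞(V,W) for all ultrafilters U, V, W. -/

import Mathlib

/-- A *poc set*: a poset with least element `⊥` and an order-reversing involution
`pstar` such that `a ≤ pstar a → a = ⊥`. -/
class PocSet (P : Type) extends PartialOrder P, OrderBot P where
  pstar : P → P
  pstar_pstar : ∀ a : P, pstar (pstar a) = a
  pstar_antitone : ∀ {a b : P}, a ≤ b → pstar b ≤ pstar a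
  eq_bot_of_le_pstar : ∀ a : P, a ≤ pstar a → a = ⊥

namespace PocSet

variable {P : Type} [PocSet P]

/-- An *ultrafilter* on a poc set: a complete `⋆`-selection (for every `a`, exactly
one of `a`, `a⋆` belongs) which is coherent (no `a, b ∈ U` satisfy `a ≤ b⋆`). -/
def IsUltra (U : Set P) : Prop :=
  (∀ a : P, a ∈ U ↔ pstar a ∉ U) ∧ ∀ a ∈ U, ∀ b ∈ U, ¬ a ≤ pstar b

/-- Two elements are *nested* if one of the four nesting relations holds. -/
def Nested (a b : P) : Prop :=
  a ≤ b ∨ a ≤ pstar b ∨ pstar a ≤ b ∨ pstar a ≤ pstar b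

/-- A set is *nested* if its elements are pairwise nested. -/
def NestedSet (N : Set P) : Prop := ∀ a ∈ N, ∀ b ∈ N, Nested a b

/-- A set is *transverse* if no two distinct elements of it are nested. -/
def Transverse (A : Set P) : Prop := ∀ a ∈ A, ∀ b ∈ A, a ≠ b → ¬ Nested a b

/-- The set of minimal elements of `V` (w.r.t. the order induced from `P`). -/
def minset (V : Set P) : Set P := {a ∈ V | ∀ b ∈ V, b ≤ a → b = a}

/-- An element is *proper* if it is neither `0` nor `0⋆`. -/
def IsProper (a : P) : Prop := a ≠ ⊥ ∧ a ≠ pstar (⊥ : P)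

/-- `d∞(U,W)`: the maximum cardinality of a nested subset of `U \ W`. -/
noncomputable def dinfty (U W : Set P) : ℕ :=
  sSup {n : ℕ | ∃ N : Set P, N ⊆ U \ W ∧ NestedSet N ∧ N.ncard = n}

/-- The `ℓ¹`-distance between ultrafilters on a finite poc set: `|U \ W|`. -/
noncomputable def ellone (U W : Set P) : ℕ := (U \ W).ncard

end PocSet

open PocSet

namespace PocSet

variable {P : Type} [PocSet P]

theorem NestedSet.mono {M N : Set P} (hN : NestedSet N) (h : M ⊆ N) : NestedSet M :=
  fun a ha b hb => hN a (h ha) b (h hb)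

theorem NestedSet.image_pstar {N : Set P} (hN : NestedSet N) : NestedSet (pstar '' N) := by
  rintro _ ⟨a, ha, rfl⟩ _ ⟨b, hb, rfl⟩
  have h := hN a ha b hb
  simp only [Nested, pstar_pstar] at h ⊢
  tauto

theorem pstar_injective : Function.Injective (pstar : P → P) :=
  Function.LeftInverse.injective pstar_pstar

theorem nestedSet_singleton (a : P) : NestedSet {a} := by
  rintro _ rfl _ rfl
  exact Or.inl le_rfl

theorem IsUltra.eq_of_subset {U W : Set P} (hU : IsUltra U) (hW : IsUltra W) (h : U ⊆ W) :
    U = W := by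
  refine h.antisymm fun a ha => ?_
  rw [hU.1 a]
  exact fun ha' => (hW.1 a).1 ha (h ha')

theorem IsUltra.pstar_mem_sdiff {U W : Set P} (hU : IsUltra U) (hW : IsUltra W) {a : P}
    (ha : a ∈ U \ W) : pstar a ∈ W \ U :=
  ⟨by_contra fun h => ha.2 ((hW.1 a).2 h), (hU.1 a).1 ha.1⟩

theorem bddAbove_ncard_nestedSet [Finite P] (U W : Set P) :
    BddAbove {n : ℕ | ∃ N : Set P, N ⊆ U \ W ∧ NestedSet N ∧ N.ncard = n} := by
  refine ⟨(U \ W).ncard, ?_⟩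
  rintro _ ⟨N, hN, -, rfl⟩
  exact Set.ncard_le_ncard hN

theorem NestedSet.ncard_le_dinfty [Finite P] {U W N : Set P} (hN : NestedSet N)
    (h : N ⊆ U \ W) : N.ncard ≤ dinfty U W :=
  le_csSup (bddAbove_ncard_nestedSet U W) ⟨N, h, hN, rfl⟩

theorem exists_ncard_eq_dinfty [Finite P] (U W : Set P) :
    ∃ N : Set P, N ⊆ U \ W ∧ NestedSet N ∧ N.ncard = dinfty U W :=
  Nat.sSup_mem (s := {n : ℕ | ∃ N : Set P, N ⊆ U \ W ∧ NestedSet N ∧ N.ncard = n})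
    ⟨0, ∅, Set.empty_subset _, by simp [NestedSet], Set.ncard_empty P⟩
    (bddAbove_ncard_nestedSet U W)

theorem subset_of_dinfty_eq_zero [Finite P] {U W : Set P} (h : dinfty U W = 0) : U ⊆ W := by
  intro a ha
  by_contra haW
  have := (nestedSet_singleton a).ncard_le_dinfty
    (Set.singleton_subset_iff.2 (show a ∈ U \ W from ⟨ha, haW⟩))
  simp [h] at this

theorem dinfty_self [Finite P] (U : Set P) : dinfty U U = 0 := by
  obtain ⟨N, hN, -, h⟩ := exists_ncard_eq_dinfty U U
  rw [Set.sdiff_self, Set.subset_empty_iff] at hN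
  rw [← h, hN, Set.ncard_empty]

theorem IsUltra.dinfty_le_swap [Finite P] {U W : Set P} (hU : IsUltra U) (hW : IsUltra W) :
    dinfty U W ≤ dinfty W U := by
  obtain ⟨N, hN, hnest, h⟩ := exists_ncard_eq_dinfty U W
  rw [← h, ← Set.ncard_image_of_injective N pstar_injective]
  apply hnest.image_pstar.ncard_le_dinfty
  rintro _ ⟨a, ha, rfl⟩
  exact hU.pstar_mem_sdiff hW (hN ha)

theorem dinfty_triangle [Finite P] (U V W : Set P) :
    dinfty U W ≤ dinfty U V + dinfty V W := by
  obtain ⟨N, hN, hnest, h⟩ := exists_ncard_eq_dinfty U W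
  have h₁ : (N \ V).ncard ≤ dinfty U V :=
    (hnest.mono Set.sdiff_subset).ncard_le_dinfty fun a ha => ⟨(hN ha.1).1, ha.2⟩
  have h₂ : (N ∩ V).ncard ≤ dinfty V W :=
    (hnest.mono Set.inter_subset_left).ncard_le_dinfty fun a ha => ⟨ha.2, (hN ha.1).2⟩
  have h₃ := Set.ncard_inter_add_ncard_sdiff_eq_ncard N V
  omega

end PocSet

/-- `d∞` is a metric on the set of ultrafilters of a finite poc set: it vanishes
exactly on the diagonal, is symmetric, and satisfies the triangle inequality. -/
theorem dinfty_is_metric {P : Type} [PocSet P] [Finite P] :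
    (∀ U W : Set P, IsUltra U → IsUltra W → (dinfty U W = 0 ↔ U = W)) ∧
    (∀ U W : Set P, IsUltra U → IsUltra W → dinfty U W = dinfty W U) ∧
    (∀ U V W : Set P, IsUltra U → IsUltra V → IsUltra W →
      dinfty U W ≤ dinfty U V + dinfty V W) := by
  refine ⟨fun U W hU hW => ⟨fun h => hU.eq_of_subset hW (subset_of_dinfty_eq_zero h), ?_⟩,
    fun U W hU hW => (hU.dinfty_le_swap hW).antisymm (hW.dinfty_le_swap hU),
    fun U V W _ _ _ => dinfty_triangle U V W⟩
  rintro rfl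
  exact dinfty_self U
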